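/- arXiv:1403.4098 — 3 statements merged into one kernel-verified Lean document; each statement's English description precedes it below -/
import Mathlib

section
/- For all x, b ∈ A with ‖x‖ ≤ 1 and ‖b‖ ≤ 1, one has φ(b* x* x b) + φ(x b b* x*) ≤ ‖b‖_φ + ‖xφ − φx‖ + ‖b*‖_φ; equivalently, (‖xb‖_φ^♯)² ≤ ‖b‖_φ + ‖xφ − φx‖ + ‖b*‖_φ. -/
open ComplexOrder

section PositiveFunctional

variable {A : Type*} [NormedRing A] [StarRing A] [NormedAlgebra ℂ A] [StarModule ℂ A]

/-- A positive functional satisfies `Re φ(d* c) = Re φ(c* d)`. -/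
theorem re_map_star_mul_comm_of_pos (φ : A →L[ℂ] ℂ) (hpos : ∀ a : A, 0 ≤ φ (star a * a))
    (c d : A) : (φ (star d * c)).re = (φ (star c * d)).re := by
  have hcd : star (c + Complex.I • d) * (c + Complex.I • d) =
      star c * c + Complex.I • (star c * d) - Complex.I • (star d * c) + star d * d := by
    simp only [star_add, star_smul, add_mul, mul_add, smul_mul_assoc, mul_smul_comm, smul_add,
      smul_neg, neg_smul, smul_smul, RCLike.star_def, Complex.conj_I, Complex.I_mul_I, neg_neg,
      one_smul, neg_mul]
    abel
  have h := (Complex.nonneg_iff.1 (hpos (c + Complex.I • d))).2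
  have hc := (Complex.nonneg_iff.1 (hpos c)).2
  have hd := (Complex.nonneg_iff.1 (hpos d)).2
  rw [hcd] at h
  simp at h
  linarith

/-- The Cauchy–Schwarz inequality for the real part of the form `(c, d) ↦ φ(c* d)`. -/
theorem re_map_star_mul_sq_le_of_pos (φ : A →L[ℂ] ℂ) (hpos : ∀ a : A, 0 ≤ φ (star a * a))
    (c d : A) :
    (φ (star c * d)).re ^ 2 ≤ (φ (star c * c)).re * (φ (star d * d)).re := by
  have hquad (t : ℝ) : 0 ≤ (φ (star d * d)).re * (t * t) +
      (2 * (φ (star c * d)).re) * t + (φ (star c * c)).re := by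
    have hcd : star (c + (t : ℂ) • d) * (c + (t : ℂ) • d) =
        star c * c + (t : ℂ) • (star c * d) + (t : ℂ) • (star d * c) +
          ((t : ℂ) * t) • (star d * d) := by
      simp only [star_add, star_smul, add_mul, mul_add, smul_mul_assoc, mul_smul_comm, smul_add,
        smul_smul, RCLike.star_def, Complex.conj_ofReal]
      abel
    have h := (Complex.nonneg_iff.1 (hpos (c + (t : ℂ) • d))).1
    rw [hcd] at h
    simp [re_map_star_mul_comm_of_pos φ hpos c d] at h
    linarith
  have h := discrim_le_zero hquad
  rw [discrim] at h
  linarith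

variable [CStarRing A] [CompleteSpace A]

/-- A state is at most `1` on `c* c` when `‖c‖ ≤ 1`. -/
theorem re_map_star_mul_self_le_one (φ : A →L[ℂ] ℂ) (hpos : ∀ a : A, 0 ≤ φ (star a * a))
    (hone : φ 1 = 1) {c : A} (hc : ‖c‖ ≤ 1) : (φ (star c * c)).re ≤ 1 := by
  let : CStarAlgebra A := {}
  let := CStarAlgebra.spectralOrder A
  have := CStarAlgebra.spectralOrderedRing A
  have hle : star c * c ≤ 1 := by
    refine (CStarAlgebra.norm_le_one_iff_of_nonneg (star c * c) (star_mul_self_nonneg c)).1 ?_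
    rw [CStarRing.norm_star_mul_self]
    exact mul_le_one₀ hc (norm_nonneg c) hc
  obtain ⟨s, hs⟩ := CStarAlgebra.nonneg_iff_eq_star_mul_self.1 (sub_nonneg.2 hle)
  have h := (Complex.nonneg_iff.1 (hpos s)).1
  rw [← hs, map_sub, hone, Complex.sub_re, Complex.one_re] at h
  linarith

/-- For a state, `Re φ(c* d) ≤ ‖d‖_φ` when `‖c‖ ≤ 1`. -/
theorem re_map_star_mul_le_sqrt (φ : A →L[ℂ] ℂ) (hpos : ∀ a : A, 0 ≤ φ (star a * a))
    (hone : φ 1 = 1) {c : A} (hc : ‖c‖ ≤ 1) (d : A) :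
    (φ (star c * d)).re ≤ Real.sqrt (φ (star d * d)).re :=
  Real.le_sqrt_of_sq_le <| (re_map_star_mul_sq_le_of_pos φ hpos c d).trans <|
    mul_le_of_le_one_left (Complex.nonneg_iff.1 (hpos d)).1
      (re_map_star_mul_self_le_one φ hpos hone hc)

end PositiveFunctional

/-- Let `A` be a unital C*-algebra and `φ : A → ℂ` a state.
For all `x, b ∈ A` with `‖x‖ ≤ 1` and `‖b‖ ≤ 1`,
`φ(b* x* x b) + φ(x b b* x*) ≤ ‖b‖_φ + ‖xφ − φx‖ + ‖b*‖_φ`,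
i.e. `(‖xb‖_φ^♯)² ≤ ‖b‖_φ + ‖xφ − φx‖ + ‖b*‖_φ`. -/
theorem sharp_norm_mul_left_bound {A : Type*} [NormedRing A] [StarRing A] [CStarRing A]
    [NormedAlgebra ℂ A] [StarModule ℂ A] [CompleteSpace A] [NormOneClass A]
    (φ : A →L[ℂ] ℂ) (hpos : ∀ a : A, 0 ≤ φ (star a * a)) (hone : φ 1 = 1)
    (x b : A) (hx : ‖x‖ ≤ 1) (hb : ‖b‖ ≤ 1) :
    (φ (star (x * b) * (x * b))).re + (φ ((x * b) * star (x * b))).re ≤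
      Real.sqrt (φ (star b * b)).re +
        ‖φ.comp ((ContinuousLinearMap.mul ℂ A).flip x) -
          φ.comp (ContinuousLinearMap.mul ℂ A x)‖ +
        Real.sqrt (φ (b * star b)).re := by
  have hx' : ‖star x‖ ≤ 1 := (norm_star x).trans_le hx
  have hb' : ‖star b‖ ≤ 1 := (norm_star b).trans_le hb
  have norm_mul_le_one {u v : A} (hu : ‖u‖ ≤ 1) (hv : ‖v‖ ≤ 1) : ‖u * v‖ ≤ 1 :=
    (norm_mul_le u v).trans (mul_le_one₀ hu (norm_nonneg v) hv)
  have hleft := re_map_star_mul_le_sqrt φ hpos hone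
    (norm_mul_le_one hx' (norm_mul_le_one hx hb)) b
  have hright := re_map_star_mul_le_sqrt φ hpos hone
    (norm_mul_le_one (norm_mul_le_one hb' hx') hx) (star b)
  rw [← re_map_star_mul_comm_of_pos φ hpos] at hright
  set ψ := φ.comp ((ContinuousLinearMap.mul ℂ A).flip x) -
    φ.comp (ContinuousLinearMap.mul ℂ A x) with hψ
  have hcomm : -(ψ (b * (star b * star x))).re ≤ ‖ψ‖ :=
    (neg_le_abs _).trans <| (Complex.abs_re_le_norm _).trans <|
      ψ.unit_le_opNorm _ (norm_mul_le_one hb (norm_mul_le_one hb' hx'))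
  simp only [hψ, sub_apply, ContinuousLinearMap.comp_apply,
    ContinuousLinearMap.flip_apply, ContinuousLinearMap.mul_apply', Complex.sub_re] at hcomm
  rw [← hψ] at hcomm
  simp only [star_mul, star_star, mul_assoc] at hleft hright hcomm ⊢
  linarith
end

section
/- For all x, b ∈ A with ‖x‖ ≤ 1 and ‖b‖ ≤ 1, one has φ(x* b* b x) + φ(b x x* b*) ≤ ‖xφ − φx‖ + ‖b‖_φ + ‖b*‖_φ; equivalently, (‖bx‖_φ^♯)² ≤ ‖xφ − φx‖ + ‖b‖_φ + ‖b*‖_φ. -/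
open ComplexOrder

/-- The unit ball of a normed ring is closed under multiplication. -/
theorem norm_mul_le_one_of_norm_le_one {A : Type*} [NonUnitalSeminormedRing A] {a b : A}
    (ha : ‖a‖ ≤ 1) (hb : ‖b‖ ≤ 1) : ‖a * b‖ ≤ 1 :=
  (norm_mul_le a b).trans (mul_le_one₀ ha (norm_nonneg b) hb)

/-- The Cauchy-Schwarz inequality for a state, with the first factor in the unit ball. -/
theorem re_state_mul_le {A : Type*} [CStarAlgebra A]
    (φ : A →L[ℂ] ℂ) (hpos : ∀ a : A, 0 ≤ φ (star a * a)) (hone : φ 1 = 1)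
    {a : A} (ha : ‖a‖ ≤ 1) (b : A) :
    (φ (star a * b)).re ≤ √(φ (star b * b)).re := by
  let _ : PartialOrder A := CStarAlgebra.spectralOrder A
  have : StarOrderedRing A := CStarAlgebra.spectralOrderedRing A
  have map_nonneg (y : A) (hy : 0 ≤ y) : 0 ≤ φ y := by
    obtain ⟨c, rfl⟩ := CStarAlgebra.nonneg_iff_eq_star_mul_self.mp hy
    exact hpos c
  have le_one : (φ (star a * a)).re ≤ 1 := by
    have h : star a * a ≤ 1 := by
      rw [← CStarAlgebra.norm_le_one_iff_of_nonneg _ (star_mul_self_nonneg a),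
        CStarRing.norm_star_mul_self]
      exact mul_le_one₀ ha (norm_nonneg a) ha
    have := (Complex.le_def.mp (map_nonneg _ (sub_nonneg.mpr h))).1
    simpa [hone] using this
  let f : A →ₚ[ℂ] ℂ := .mk₀ φ.toLinearMap map_nonneg
  calc (φ (star a * b)).re ≤ ‖φ (star a * b)‖ := Complex.re_le_norm _
    _ ≤ √(φ (star a * a)).re * √(φ (star b * b)).re :=
      norm_inner_le_norm (𝕜 := ℂ) (f.toPreGNS a) (f.toPreGNS b)
    _ ≤ √(φ (star b * b)).re :=
      mul_le_of_le_one_left (Real.sqrt_nonneg _) (Real.sqrt_le_one.mpr le_one)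

/-- Let `A` be a unital C*-algebra and `φ : A → ℂ` a state.
For all `x, b ∈ A` with `‖x‖ ≤ 1` and `‖b‖ ≤ 1`,
`φ(x* b* b x) + φ(b x x* b*) ≤ ‖xφ − φx‖ + ‖b‖_φ + ‖b*‖_φ`,
i.e. `(‖bx‖_φ^♯)² ≤ ‖xφ − φx‖ + ‖b‖_φ + ‖b*‖_φ`. -/
theorem sharp_norm_mul_right_bound {A : Type*} [NormedRing A] [StarRing A] [CStarRing A]
    [NormedAlgebra ℂ A] [StarModule ℂ A] [CompleteSpace A] [NormOneClass A]
    (φ : A →L[ℂ] ℂ) (hpos : ∀ a : A, 0 ≤ φ (star a * a)) (hone : φ 1 = 1)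
    (x b : A) (hx : ‖x‖ ≤ 1) (hb : ‖b‖ ≤ 1) :
    (φ (star (b * x) * (b * x))).re + (φ ((b * x) * star (b * x))).re ≤
      ‖φ.comp ((ContinuousLinearMap.mul ℂ A).flip x) -
        φ.comp (ContinuousLinearMap.mul ℂ A x)‖ +
      Real.sqrt (φ (star b * b)).re + Real.sqrt (φ (b * star b)).re := by
  let _ : CStarAlgebra A := { }
  have hx' : ‖star x‖ ≤ 1 := by rwa [norm_star]
  have hb' : ‖star b‖ ≤ 1 := by rwa [norm_star]
  have hbxx : ‖b * x * star x‖ ≤ 1 :=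
    norm_mul_le_one_of_norm_le_one (norm_mul_le_one_of_norm_le_one hb hx) hx'
  have hxxb : ‖x * star x * star b‖ ≤ 1 :=
    norm_mul_le_one_of_norm_le_one (norm_mul_le_one_of_norm_le_one hx hx') hb'
  have hxbb : ‖star x * star b * b‖ ≤ 1 :=
    norm_mul_le_one_of_norm_le_one (norm_mul_le_one_of_norm_le_one hx' hb') hb
  set ψ := φ.comp ((ContinuousLinearMap.mul ℂ A).flip x) -
    φ.comp (ContinuousLinearMap.mul ℂ A x) with hψ
  have commutator_bound : (ψ (star x * star b * b)).re ≤ ‖ψ‖ :=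
    (Complex.re_le_norm _).trans (ψ.unit_le_opNorm _ hxbb)
  have left_bound : (φ (star (b * x * star x) * b)).re ≤ √(φ (star b * b)).re :=
    re_state_mul_le φ hpos hone hbxx b
  have right_bound : (φ (star (x * star x * star b) * star b)).re ≤
      √(φ (star (star b) * star b)).re :=
    re_state_mul_le φ hpos hone hxxb (star b)
  simp only [hψ, sub_apply, ContinuousLinearMap.comp_apply,
    ContinuousLinearMap.flip_apply, ContinuousLinearMap.mul_apply', Complex.sub_re]
    at commutator_bound
  simp only [star_mul, star_star, mul_assoc] at commutator_bound left_bound right_bound ⊢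
  linarith
end

section
/- Let (x_n) and (b_n) be sequences in the closed unit ball of A such that ‖x_n φ − φ x_n‖ → 0 and ‖b_n‖_φ^♯ → 0 along a filter F on ℕ. Then ‖x_n b_n‖_φ^♯ → 0 and ‖b_n x_n‖_φ^♯ → 0 along F. -/
open ComplexOrder

lemma norm_map_mul_sub_map_mul_le {A : Type*} [NormedRing A] [NormedAlgebra ℂ A]
    (φ : A →L[ℂ] ℂ) (x : A) {y : A} (hy : ‖y‖ ≤ 1) :
    ‖φ (y * x) - φ (x * y)‖ ≤ ‖φ.comp ((ContinuousLinearMap.mul ℂ A).flip x) -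
      φ.comp (ContinuousLinearMap.mul ℂ A x)‖ := by
  simpa using ContinuousLinearMap.unit_le_opNorm
    (φ.comp ((ContinuousLinearMap.mul ℂ A).flip x) - φ.comp (ContinuousLinearMap.mul ℂ A x)) y hy

section PositiveFunctional

variable {A : Type*} [NormedRing A] [StarRing A] [NormedAlgebra ℂ A] [StarModule ℂ A]

/-- The sesquilinear form `(u, v) ↦ φ (star u * v)` of a positive functional is Hermitian. -/
lemma conj_map_star_mul {φ : A →L[ℂ] ℂ} (hpos : ∀ a : A, 0 ≤ φ (star a * a)) (u v : A) :
    starRingEnd ℂ (φ (star v * u)) = φ (star u * v) := by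
  have him (a : A) : (φ (star a * a)).im = 0 := (Complex.nonneg_iff.mp (hpos a)).2.symm
  have hu := him u
  have hv := him v
  have hsum := him (u + v)
  have hsumI := him (u + Complex.I • v)
  simp only [star_add, star_smul, add_mul, mul_add, map_add, smul_mul_assoc, mul_smul_comm,
    map_smul, smul_eq_mul, Complex.add_im, Complex.mul_im, Complex.mul_re, Complex.I_re,
    Complex.I_im, Complex.star_def, Complex.conj_I, Complex.neg_re, Complex.neg_im] at hsum hsumI
  apply Complex.ext
  · rw [Complex.conj_re]
    linarith
  · rw [Complex.conj_im]
    linarith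

/-- The Cauchy–Schwarz inequality for a positive functional. -/
lemma norm_map_star_mul_le {φ : A →L[ℂ] ℂ} (hpos : ∀ a : A, 0 ≤ φ (star a * a)) (u v : A) :
    ‖φ (star u * v)‖ ≤ √(φ (star u * u)).re * √(φ (star v * v)).re := by
  let core : PreInnerProductSpace.Core ℂ A :=
    { inner := fun u v => φ (star u * v)
      conj_inner_symm := conj_map_star_mul hpos
      re_inner_nonneg := fun a => (Complex.nonneg_iff.mp (hpos a)).1
      add_left := fun a b c => by simp [add_mul]
      smul_left := fun a b r => by simp }
  exact InnerProductSpace.Core.norm_inner_le_norm (𝕜 := ℂ) (c := core) u v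

lemma norm_map_star_mul_le_of_norm_le_one [CStarRing A] {φ : A →L[ℂ] ℂ}
    (hpos : ∀ a : A, 0 ≤ φ (star a * a)) (u : A) {v : A} (hv : ‖v‖ ≤ 1) :
    ‖φ (star u * v)‖ ≤ √(φ (star u * u)).re * √‖φ‖ := by
  refine (norm_map_star_mul_le hpos u v).trans ?_
  gcongr
  calc (φ (star v * v)).re ≤ ‖φ (star v * v)‖ := Complex.re_le_norm _
    _ ≤ ‖φ‖ * ‖star v * v‖ := φ.le_opNorm _
    _ ≤ ‖φ‖ * 1 := by
        gcongr
        rw [CStarRing.norm_star_mul_self]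
        exact mul_le_one₀ hv (norm_nonneg v) hv
    _ = ‖φ‖ := mul_one _

lemma sharp_norm_sq_mul_le [CStarRing A] {φ : A →L[ℂ] ℂ}
    (hpos : ∀ a : A, 0 ≤ φ (star a * a)) {x b : A} (hx : ‖x‖ ≤ 1) (hb : ‖b‖ ≤ 1) :
    (φ (star (x * b) * (x * b))).re + (φ ((x * b) * star (x * b))).re ≤
        2 * √‖φ‖ * √((φ (star b * b)).re + (φ (b * star b)).re) +
          ‖φ.comp ((ContinuousLinearMap.mul ℂ A).flip x) -
            φ.comp (ContinuousLinearMap.mul ℂ A x)‖ ∧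
      (φ (star (b * x) * (b * x))).re + (φ ((b * x) * star (b * x))).re ≤
        2 * √‖φ‖ * √((φ (star b * b)).re + (φ (b * star b)).re) +
          ‖φ.comp ((ContinuousLinearMap.mul ℂ A).flip x) -
            φ.comp (ContinuousLinearMap.mul ℂ A x)‖ := by
  have hmul {c d : A} (hc : ‖c‖ ≤ 1) (hd : ‖d‖ ≤ 1) : ‖c * d‖ ≤ 1 :=
    (norm_mul_le c d).trans (mul_le_one₀ hc (norm_nonneg d) hd)
  have hx' : ‖star x‖ ≤ 1 := by rwa [norm_star]
  have hb' : ‖star b‖ ≤ 1 := by rwa [norm_star]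
  have hbb : 0 ≤ (φ (star b * b)).re := (Complex.nonneg_iff.mp (hpos b)).1
  have hbb' : 0 ≤ (φ (b * star b)).re := by
    simpa using (Complex.nonneg_iff.mp (hpos (star b))).1
  set s := √((φ (star b * b)).re + (φ (b * star b)).re)
  have hleft {v : A} (hv : ‖v‖ ≤ 1) : ‖φ (star b * v)‖ ≤ s * √‖φ‖ := by
    refine (norm_map_star_mul_le_of_norm_le_one hpos b hv).trans ?_
    gcongr
    exact Real.sqrt_le_sqrt (by linarith)
  have hright {v : A} (hv : ‖v‖ ≤ 1) : ‖φ (b * v)‖ ≤ s * √‖φ‖ := by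
    have h := norm_map_star_mul_le_of_norm_le_one hpos (star b) hv
    rw [star_star] at h
    refine h.trans ?_
    gcongr
    exact Real.sqrt_le_sqrt (by linarith)
  constructor
  · have h₁ := (Complex.re_le_norm _).trans (hleft (hmul hx' (hmul hx hb)))
    have h₂ := (Complex.re_le_norm _).trans (hright (hmul hb' (hmul hx' hx)))
    have h₃ := (Complex.abs_re_le_norm _).trans
      (norm_map_mul_sub_map_mul_le φ x (hmul hb (hmul hb' hx')))
    rw [Complex.sub_re, abs_le] at h₃
    simp only [star_mul, mul_assoc] at h₁ h₂ h₃ ⊢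
    linarith [h₃.1]
  · have h₁ := (Complex.re_le_norm _).trans (hright (hmul hx (hmul hx' hb')))
    have h₂ : (φ (x * (star x * (star b * b)))).re ≤ s * √‖φ‖ := by
      have h := (Complex.re_le_norm _).trans (hleft (hmul hb (hmul hx hx')))
      rw [← Complex.conj_re, conj_map_star_mul hpos] at h
      simpa only [star_mul, star_star, mul_assoc] using h
    have h₃ := (Complex.abs_re_le_norm _).trans
      (norm_map_mul_sub_map_mul_le φ x (hmul hx' (hmul hb' hb)))
    rw [Complex.sub_re, abs_le] at h₃
    simp only [star_mul, mul_assoc] at h₁ h₂ h₃ ⊢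
    linarith [h₃.2]

end PositiveFunctional

/-- Let `A` be a unital C*-algebra and `φ : A → ℂ` a state.
If `(x n)` and `(b n)` are sequences in the closed unit ball of `A` such that
`‖x_n φ − φ x_n‖ → 0` and `‖b_n‖_φ^♯ → 0` along a filter `F`, then
`‖x_n b_n‖_φ^♯ → 0` and `‖b_n x_n‖_φ^♯ → 0` along `F`. -/
theorem sharp_norm_mul_tendsto_zero {A : Type*} [NormedRing A] [StarRing A] [CStarRing A]
    [NormedAlgebra ℂ A] [StarModule ℂ A] [CompleteSpace A] [NormOneClass A]
    (φ : A →L[ℂ] ℂ) (hpos : ∀ a : A, 0 ≤ φ (star a * a)) (hone : φ 1 = 1)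
    (x b : ℕ → A) (hx : ∀ n, ‖x n‖ ≤ 1) (hb : ∀ n, ‖b n‖ ≤ 1)
    (F : Filter ℕ)
    (hcomm : Filter.Tendsto
      (fun n => ‖φ.comp ((ContinuousLinearMap.mul ℂ A).flip (x n)) -
        φ.comp (ContinuousLinearMap.mul ℂ A (x n))‖) F (nhds 0))
    (hbsharp : Filter.Tendsto
      (fun n => Real.sqrt ((φ (star (b n) * b n)).re + (φ (b n * star (b n))).re))
      F (nhds 0)) :
    Filter.Tendsto
      (fun n => Real.sqrt ((φ (star (x n * b n) * (x n * b n))).re +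
        (φ ((x n * b n) * star (x n * b n))).re)) F (nhds 0) ∧
    Filter.Tendsto
      (fun n => Real.sqrt ((φ (star (b n * x n) * (b n * x n))).re +
        (φ ((b n * x n) * star (b n * x n))).re)) F (nhds 0) := by
  have hbound := (hbsharp.const_mul (2 * √‖φ‖)).add hcomm
  rw [mul_zero, add_zero] at hbound
  have hsqrt := hbound.sqrt
  rw [Real.sqrt_zero] at hsqrt
  exact ⟨squeeze_zero (fun n => Real.sqrt_nonneg _)
      (fun n => Real.sqrt_le_sqrt (sharp_norm_sq_mul_le hpos (hx n) (hb n)).1) hsqrt,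
    squeeze_zero (fun n => Real.sqrt_nonneg _)
      (fun n => Real.sqrt_le_sqrt (sharp_norm_sq_mul_le hpos (hx n) (hb n)).2) hsqrt⟩
end
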